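/- μ-almost surely, θ̂_n → θ and (Ĥ_n, γ̂_n², σ̂_n²) → (H, γ², σ²) as n → ∞; i.e., the generalized-method-of-moments estimators of the Hurst index, the fractional scaling parameter and the Brownian volatility built from one discretely observed trajectory are strongly consistent. -/

import Mathlib

open MeasureTheory Filter Set Finset

noncomputable def rhoH (H : ℝ) (k : ℤ) : ℝ :=
  (|(k : ℝ) + 1| ^ (2 * H) + |(k : ℝ) - 1| ^ (2 * H) - 2 * |(k : ℝ)| ^ (2 * H)) / 2

noncomputable def mixedCov (σ γ h H : ℝ) (k : ℤ) : ℝ :=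
  σ ^ 2 * h * (if k = 0 then 1 else 0) + γ ^ 2 * h ^ (2 * H) * rhoH H k

def shift : (ℕ → ℝ) → (ℕ → ℝ) := fun ω k => ω (k + 1)

/-- The drifted increments `Y_k(ω) = θ h + ω_k`. -/
noncomputable def Yinc (θ h : ℝ) (ω : ℕ → ℝ) (k : ℕ) : ℝ := θ * h + ω k

noncomputable def xiStat (θ h : ℝ) (n : ℕ) (ω : ℕ → ℝ) : ℝ :=
  (1 / (n : ℝ)) * ∑ k ∈ Finset.range n, (Yinc θ h ω k) ^ 2

noncomputable def etaStat (θ h : ℝ) (n : ℕ) (ω : ℕ → ℝ) : ℝ :=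
  (1 / (n : ℝ)) * ∑ k ∈ Finset.range n, Yinc θ h ω k * Yinc θ h ω (k + 1)

noncomputable def zetaStat (θ h : ℝ) (n : ℕ) (ω : ℕ → ℝ) : ℝ :=
  (1 / (n : ℝ)) * ∑ k ∈ Finset.range n,
    (Yinc θ h ω k + Yinc θ h ω (k + 1)) * (Yinc θ h ω (k + 2) + Yinc θ h ω (k + 3))

noncomputable def thetaHat (θ h : ℝ) (n : ℕ) (ω : ℕ → ℝ) : ℝ :=
  (1 / ((n : ℝ) * h)) * ∑ k ∈ Finset.range n, Yinc θ h ω k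

/-- `log₂⁺(x) = log₂ x` for `x > 0` and `0` otherwise. -/
noncomputable def log2plus (x : ℝ) : ℝ := if 0 < x then Real.logb 2 x else 0

noncomputable def Hhat (θ h : ℝ) (n : ℕ) (ω : ℕ → ℝ) : ℝ :=
  (1 / 2) * log2plus ((zetaStat θ h n ω - 4 * h ^ 2 * (thetaHat θ h n ω) ^ 2) /
    (etaStat θ h n ω - h ^ 2 * (thetaHat θ h n ω) ^ 2))

noncomputable def gammaSqHat (θ h : ℝ) (n : ℕ) (ω : ℕ → ℝ) : ℝ :=
  (etaStat θ h n ω - h ^ 2 * (thetaHat θ h n ω) ^ 2) /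
    (h ^ (2 * Hhat θ h n ω) * ((2 : ℝ) ^ (2 * Hhat θ h n ω - 1) - 1))

noncomputable def sigmaSqHat (θ h : ℝ) (n : ℕ) (ω : ℕ → ℝ) : ℝ :=
  (xiStat θ h n ω - h ^ 2 * (thetaHat θ h n ω) ^ 2 -
    gammaSqHat θ h n ω * h ^ (2 * Hhat θ h n ω)) / h


lemma gauss_moments (v : NNReal) :
    (∫ x, x ^ 2 ∂(ProbabilityTheory.gaussianReal 0 v) = v) ∧
    (∫ x, x ^ 3 ∂(ProbabilityTheory.gaussianReal 0 v) = 0) ∧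
    (∫ x, x ^ 4 ∂(ProbabilityTheory.gaussianReal 0 v) = 3 * (v : ℝ) ^ 2) := by
  have key : ∀ n : ℕ, ∫ x, x ^ n ∂(ProbabilityTheory.gaussianReal 0 v)
      = iteratedDeriv n (fun t : ℝ => Real.exp ((v : ℝ) * t ^ 2 / 2)) 0 := by
    intro n
    have h := ProbabilityTheory.iteratedDeriv_mgf_zero (X := id)
      (μ := ProbabilityTheory.gaussianReal 0 v) (by simp) n
    rw [ProbabilityTheory.mgf_id_gaussianReal] at h
    simpa using h.symm
  have hE : ∀ t : ℝ, HasDerivAt (fun t : ℝ => Real.exp ((v : ℝ) * t ^ 2 / 2))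
      ((v : ℝ) * t * Real.exp ((v : ℝ) * t ^ 2 / 2)) t := by
    intro t
    have h1 : HasDerivAt (fun t : ℝ => (v : ℝ) * t ^ 2 / 2) ((v : ℝ) * t) t := by
      have := ((hasDerivAt_pow 2 t).const_mul (v : ℝ)).div_const 2
      exact this.congr_deriv (by push_cast; ring)
    exact h1.exp.congr_deriv (by ring)
  have step : ∀ (p p' : ℝ → ℝ), (∀ t, HasDerivAt p (p' t) t) →
      deriv (fun t : ℝ => p t * Real.exp ((v : ℝ) * t ^ 2 / 2)) =
      fun t => (p' t + v * t * p t) * Real.exp ((v : ℝ) * t ^ 2 / 2) := by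
    intro p p' hp
    funext t
    refine HasDerivAt.deriv ?_
    exact ((hp t).fun_mul (hE t)).congr_deriv (by ring)
  have d1 : iteratedDeriv 1 (fun t : ℝ => Real.exp ((v : ℝ) * t ^ 2 / 2)) =
      fun t => ((v : ℝ) * t) * Real.exp ((v : ℝ) * t ^ 2 / 2) := by
    rw [iteratedDeriv_one]; funext t; exact (hE t).deriv
  have d2 : iteratedDeriv 2 (fun t : ℝ => Real.exp ((v : ℝ) * t ^ 2 / 2)) =
      fun t => ((v : ℝ) + v ^ 2 * t ^ 2) * Real.exp ((v : ℝ) * t ^ 2 / 2) := by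
    rw [iteratedDeriv_succ, d1, step (fun t => (v : ℝ) * t) (fun t => (v : ℝ))]
    · funext t; ring
    · intro t; simpa using (hasDerivAt_id t).const_mul (v : ℝ)
  have d3 : iteratedDeriv 3 (fun t : ℝ => Real.exp ((v : ℝ) * t ^ 2 / 2)) =
      fun t => (3 * (v : ℝ) ^ 2 * t + v ^ 3 * t ^ 3) * Real.exp ((v : ℝ) * t ^ 2 / 2) := by
    rw [iteratedDeriv_succ, d2, step (fun t => (v : ℝ) + v ^ 2 * t ^ 2) (fun t => 2 * (v : ℝ) ^ 2 * t)]
    · funext t; ring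
    · intro t
      exact (((hasDerivAt_pow 2 t).const_mul ((v : ℝ) ^ 2)).const_add (v : ℝ)).congr_deriv
        (by push_cast; ring)
  have d4 : iteratedDeriv 4 (fun t : ℝ => Real.exp ((v : ℝ) * t ^ 2 / 2)) =
      fun t => (3 * (v : ℝ) ^ 2 + 6 * v ^ 3 * t ^ 2 + v ^ 4 * t ^ 4) *
        Real.exp ((v : ℝ) * t ^ 2 / 2) := by
    rw [iteratedDeriv_succ, d3, step (fun t => 3 * (v : ℝ) ^ 2 * t + v ^ 3 * t ^ 3)
      (fun t => 3 * (v : ℝ) ^ 2 + 3 * v ^ 3 * t ^ 2)]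
    · funext t; ring
    · intro t
      exact (((hasDerivAt_id t).const_mul (3 * (v : ℝ) ^ 2)).fun_add
        ((hasDerivAt_pow 3 t).const_mul ((v : ℝ) ^ 3))).congr_deriv (by push_cast; ring)
  refine ⟨?_, ?_, ?_⟩
  · rw [key, d2]; simp
  · rw [key, d3]; simp
  · rw [key, d4]; simp

lemma slln_aux {Ω : Type*} [MeasurableSpace Ω] (μ : Measure Ω)
    (S : ℕ → Ω → ℝ) (m C p : ℝ) (hp : p < 2) (hC : 0 ≤ C)
    (hmeas : ∀ n, Measurable (S n))
    (hmono : ∀ ω, Monotone fun n => S n ω)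
    (hint : ∀ n, Integrable (fun ω => (S n ω - n * m) ^ 2) μ)
    (hvar : ∀ n : ℕ, 1 ≤ n → ∫ ω, (S n ω - n * m) ^ 2 ∂μ ≤ C * (n : ℝ) ^ p) :
    ∀ᵐ ω ∂μ, Tendsto (fun n : ℕ => S n ω / n) atTop (nhds m) := by
  have sub : ∀ c : ℝ, 1 < c → ∀ᵐ ω ∂μ,
      Tendsto (fun n : ℕ => S ⌊c ^ n⌋₊ ω / ⌊c ^ n⌋₊) atTop (nhds m) := by
    intro c hc
    have hc0 : 0 < c := by linarith
    have hN1 : ∀ n : ℕ, 1 ≤ ⌊c ^ n⌋₊ := fun n =>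
      Nat.le_floor (by simpa using one_le_pow₀ hc.le)
    have hd : 0 < 1 - c⁻¹ := by
      have := inv_lt_one_of_one_lt₀ hc; linarith
    let q := c ^ (p - 2)
    have hq0 : 0 ≤ q := by positivity
    have hq1 : q < 1 := Real.rpow_lt_one_of_one_lt_of_neg hc (by linarith)
    let D := C * (1 - c⁻¹) ^ (p - 2)
    have hD : 0 ≤ D := by positivity
    let F : ℕ → Ω → ℝ := fun n ω => (S ⌊c ^ n⌋₊ ω / ⌊c ^ n⌋₊ - m) ^ 2
    have hF : ∀ n ω, F n ω = (S ⌊c ^ n⌋₊ ω - ⌊c ^ n⌋₊ * m) ^ 2 * (((⌊c ^ n⌋₊ : ℕ) : ℝ) ^ 2)⁻¹ := by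
      intro n ω
      have : ((⌊c ^ n⌋₊ : ℕ) : ℝ) ≠ 0 := by have := hN1 n; positivity
      simp only [F]; field_simp
    have hFint : ∀ n, Integrable (F n) μ := by
      intro n
      have := (hint ⌊c ^ n⌋₊).mul_const ((((⌊c ^ n⌋₊ : ℕ) : ℝ) ^ 2)⁻¹)
      exact this.congr (ae_of_all _ fun ω => (hF n ω).symm)
    have hFb : ∀ n, ∫ ω, F n ω ∂μ ≤ D * q ^ n := by
      intro n
      have hNpos : (0 : ℝ) < ((⌊c ^ n⌋₊ : ℕ) : ℝ) := by have := hN1 n; positivity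
      calc ∫ ω, F n ω ∂μ = (∫ ω, (S ⌊c ^ n⌋₊ ω - ⌊c ^ n⌋₊ * m) ^ 2 ∂μ) *
            (((⌊c ^ n⌋₊ : ℕ) : ℝ) ^ 2)⁻¹ := by
            rw [← integral_mul_const]; simp_rw [hF]
        _ ≤ (C * ((⌊c ^ n⌋₊ : ℕ) : ℝ) ^ p) * (((⌊c ^ n⌋₊ : ℕ) : ℝ) ^ 2)⁻¹ := by
            gcongr; exact hvar _ (hN1 n)
        _ = C * ((⌊c ^ n⌋₊ : ℕ) : ℝ) ^ (p - 2) := by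
            rw [Real.rpow_sub hNpos]; norm_num; ring
        _ ≤ C * ((1 - c⁻¹) * c ^ n) ^ (p - 2) := by
            refine mul_le_mul_of_nonneg_left ?_ hC
            exact Real.rpow_le_rpow_of_nonpos (by positivity) (mul_pow_le_nat_floor_pow hc n)
              (by linarith)
        _ = D * q ^ n := by
            rw [Real.mul_rpow hd.le (by positivity)]
            simp only [D, q]
            rw [← Real.rpow_natCast, ← Real.rpow_natCast, ← Real.rpow_mul hc0.le,
              ← Real.rpow_mul hc0.le, mul_comm (n : ℝ)]; ring
    have hFm : ∀ n, Measurable (F n) := fun n => by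
      simp only [F]; have := hmeas ⌊c ^ n⌋₊; fun_prop
    have htot : ∫⁻ ω, ∑' n, ENNReal.ofReal (F n ω) ∂μ ≠ ⊤ := by
      rw [lintegral_tsum (fun n => (hFm n).ennreal_ofReal.aemeasurable)]
      have h1 : ∀ n, ∫⁻ ω, ENNReal.ofReal (F n ω) ∂μ ≤ ENNReal.ofReal (D * q ^ n) := by
        intro n
        rw [← ofReal_integral_eq_lintegral_ofReal (hFint n) (ae_of_all _ fun ω => sq_nonneg _)]
        exact ENNReal.ofReal_le_ofReal (hFb n)
      refine ne_top_of_le_ne_top ?_ (ENNReal.tsum_le_tsum h1)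
      exact ((summable_geometric_of_lt_one hq0 hq1).mul_left D).tsum_ofReal_ne_top
    have hae := ae_lt_top (Measurable.tsum fun n => (hFm n).ennreal_ofReal) htot
    filter_upwards [hae] with ω hω
    have h2 := ENNReal.tendsto_cofinite_zero_of_tsum_ne_top hω.ne
    rw [Nat.cofinite_eq_atTop] at h2
    have h3 : Tendsto (fun n => F n ω) atTop (nhds 0) := by
      have := (ENNReal.tendsto_toReal ENNReal.zero_ne_top).comp h2
      refine this.congr fun n => ?_
      simp only [Function.comp]
      exact ENNReal.toReal_ofReal (sq_nonneg _)
    have h4 := h3.sqrt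
    simp only [F, Real.sqrt_sq_eq_abs, Real.sqrt_zero] at h4
    have h5 := (tendsto_zero_iff_abs_tendsto_zero _).2 h4
    simpa using h5.add_const m
  have all : ∀ᵐ ω ∂μ, ∀ k : ℕ,
      Tendsto (fun n : ℕ => S ⌊(1 + 1 / ((k : ℝ) + 1)) ^ n⌋₊ ω / ⌊(1 + 1 / ((k : ℝ) + 1)) ^ n⌋₊)
        atTop (nhds m) := by
    rw [ae_all_iff]; intro k
    exact sub _ (by have : (0:ℝ) < 1 / ((k : ℝ) + 1) := by positivity
                    linarith)
  filter_upwards [all] with ω hω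
  refine tendsto_div_of_monotone_of_tendsto_div_floor_pow (fun n => S n ω) m (hmono ω)
    (fun k => 1 + 1 / ((k : ℝ) + 1)) (fun k => ?_) ?_ hω
  · have : (0:ℝ) < 1 / ((k : ℝ) + 1) := by positivity
    linarith
  · simpa using (tendsto_one_div_add_atTop_nhds_zero_nat (𝕜 := ℝ)).const_add 1

lemma MeasureTheory.Integrable.fsub {Ω : Type*} [MeasurableSpace Ω] {μ : Measure Ω} {f g : Ω → ℝ}
    (hf : Integrable f μ) (hg : Integrable g μ) : Integrable (fun x => f x - g x) μ := hf.sub hg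

def linV : Submodule ℝ ((ℕ → ℝ) → ℝ) :=
  Submodule.span ℝ (Set.range fun (k : ℕ) (ω : ℕ → ℝ) => ω k)

def GaussV (μ : Measure (ℕ → ℝ)) : Prop :=
  ∀ u ∈ linV, Measurable u ∧ ∃ v : NNReal, Measure.map u μ = ProbabilityTheory.gaussianReal 0 v

lemma coord_mem (k : ℕ) : (fun ω : ℕ → ℝ => ω k) ∈ linV :=
  Submodule.subset_span ⟨k, rfl⟩

lemma mom1 {μ : Measure (ℕ → ℝ)} (hG : GaussV μ) {u : (ℕ → ℝ) → ℝ} (hu : u ∈ linV) :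
    Integrable (fun ω => u ω ^ 2) μ ∧ Integrable (fun ω => u ω ^ 3) μ ∧
    Integrable (fun ω => u ω ^ 4) μ ∧
    ∫ ω, u ω ^ 3 ∂μ = 0 ∧ ∫ ω, u ω ^ 4 ∂μ = 3 * (∫ ω, u ω ^ 2 ∂μ) ^ 2 := by
  obtain ⟨hm, v, hv⟩ := hG u hu
  have hi : ∀ n : ℕ, n ≠ 0 → Integrable (fun ω => u ω ^ n) μ := by
    intro n hn
    have h1 : Integrable (fun x : ℝ => x ^ n) (Measure.map u μ) := by
      rw [hv]
      have h := (ProbabilityTheory.memLp_id_gaussianReal (μ := 0) (v := v) n).integrable_norm_pow hn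
      refine (integrable_norm_iff (by fun_prop)).1 ?_
      simpa using h
    exact h1.comp_measurable hm
  have he : ∀ n : ℕ, ∫ ω, u ω ^ n ∂μ = ∫ x, x ^ n ∂(ProbabilityTheory.gaussianReal 0 v) := by
    intro n
    rw [← hv, integral_map hm.aemeasurable (by fun_prop)]
  obtain ⟨m2, m3, m4⟩ := gauss_moments v
  refine ⟨hi 2 (by simp), hi 3 (by simp), hi 4 (by simp), ?_, ?_⟩
  · rw [he, m3]
  · rw [he, he, m2, m4]

lemma mom2 {μ : Measure (ℕ → ℝ)} (hG : GaussV μ) {u v : (ℕ → ℝ) → ℝ}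
    (hu : u ∈ linV) (hv : v ∈ linV) :
    Integrable (fun ω => u ω * v ω) μ ∧
    Integrable (fun ω => u ω ^ 2 * v ω) μ ∧ ∫ ω, u ω ^ 2 * v ω ∂μ = 0 ∧
    Integrable (fun ω => u ω ^ 2 * v ω ^ 2) μ ∧
    ∫ ω, u ω ^ 2 * v ω ^ 2 ∂μ =
      (∫ ω, u ω ^ 2 ∂μ) * (∫ ω, v ω ^ 2 ∂μ) + 2 * (∫ ω, u ω * v ω ∂μ) ^ 2 := by
  obtain ⟨p2, p3, p4, pe3, pe4⟩ := mom1 hG (linV.add_mem hu hv)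
  obtain ⟨q2, q3, q4, qe3, qe4⟩ := mom1 hG (linV.sub_mem hu hv)
  obtain ⟨u2, u3, u4, ue3, ue4⟩ := mom1 hG hu
  obtain ⟨v2, v3, v4, ve3, ve4⟩ := mom1 hG hv
  simp only [Pi.add_apply, Pi.sub_apply] at *
  have e1 : (fun ω => u ω * v ω) = fun ω => (1/4) * ((u ω + v ω) ^ 2 - (u ω - v ω) ^ 2) := by
    funext ω; ring
  have e2 : (fun ω => u ω ^ 2 * v ω) =
      fun ω => (1/6) * ((u ω + v ω) ^ 3 - (u ω - v ω) ^ 3 - 2 * v ω ^ 3) := by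
    funext ω; ring
  have e3 : (fun ω => u ω ^ 2 * v ω ^ 2) =
      fun ω => (1/12) * ((u ω + v ω) ^ 4 + (u ω - v ω) ^ 4 - 2 * u ω ^ 4 - 2 * v ω ^ 4) := by
    funext ω; ring
  have i1 : Integrable (fun ω => u ω * v ω) μ := by
    rw [e1]; exact (p2.fsub q2).const_mul _
  refine ⟨i1, ?_, ?_, ?_, ?_⟩
  · rw [e2]; exact ((p3.fsub q3).fsub (v3.const_mul 2)).const_mul _
  · rw [e2, integral_const_mul, integral_sub (p3.fsub q3) (v3.const_mul 2), integral_sub p3 q3,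
      integral_const_mul, pe3, qe3, ve3]; simp
  · rw [e3]; exact (((p4.fun_add q4).fsub (u4.const_mul 2)).fsub (v4.const_mul 2)).const_mul _
  · have s1 : ∫ ω, (u ω + v ω) ^ 2 ∂μ =
        ∫ ω, u ω ^ 2 ∂μ + ∫ ω, v ω ^ 2 ∂μ + 2 * ∫ ω, u ω * v ω ∂μ := by
      rw [← integral_const_mul, ← integral_add u2 v2, ← integral_add (u2.fun_add v2) (i1.const_mul 2)]
      congr 1; funext ω; ring
    have s2 : ∫ ω, (u ω - v ω) ^ 2 ∂μ =
        ∫ ω, u ω ^ 2 ∂μ + ∫ ω, v ω ^ 2 ∂μ - 2 * ∫ ω, u ω * v ω ∂μ := by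
      rw [← integral_const_mul, ← integral_add u2 v2, ← integral_sub (u2.fun_add v2) (i1.const_mul 2)]
      congr 1; funext ω; ring
    rw [e3, integral_const_mul, integral_sub ((p4.fun_add q4).fsub (u4.const_mul 2)) (v4.const_mul 2),
      integral_sub (p4.fun_add q4) (u4.const_mul 2), integral_add p4 q4,
      integral_const_mul, integral_const_mul, pe4, qe4, ue4, ve4, s1, s2]; ring

lemma mean0 {μ : Measure (ℕ → ℝ)} (hG : GaussV μ) {u : (ℕ → ℝ) → ℝ} (hu : u ∈ linV) :
    Integrable u μ ∧ ∫ ω, u ω ∂μ = 0 := by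
  obtain ⟨hm, v, hv⟩ := hG u hu
  constructor
  · have h1 : Integrable (fun x : ℝ => x) (Measure.map u μ) := by
      rw [hv]
      exact (ProbabilityTheory.memLp_id_gaussianReal (μ := 0) (v := v) 1).integrable (by simp)
    exact h1.comp_measurable hm
  · have := integral_map (μ := μ) hm.aemeasurable (f := fun x : ℝ => x) (by fun_prop)
    rw [← this, hv, ProbabilityTheory.integral_id_gaussianReal]

lemma cov_sq {μ : Measure (ℕ → ℝ)} [IsProbabilityMeasure μ] (hG : GaussV μ)
    {u v : (ℕ → ℝ) → ℝ} (hu : u ∈ linV) (hv : v ∈ linV) (b s : ℝ)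
    (hus : ∫ ω, u ω ^ 2 ∂μ = s) (hvs : ∫ ω, v ω ^ 2 ∂μ = s) :
    Integrable (fun ω => ((b + u ω) ^ 2 - (b ^ 2 + s)) * ((b + v ω) ^ 2 - (b ^ 2 + s))) μ ∧
    ∫ ω, ((b + u ω) ^ 2 - (b ^ 2 + s)) * ((b + v ω) ^ 2 - (b ^ 2 + s)) ∂μ ≤
      (2 * s + 4 * b ^ 2) * |∫ ω, u ω * v ω ∂μ| := by
  obtain ⟨i1, i2, e2, i3, e3⟩ := mom2 hG hu hv
  obtain ⟨-, j2, f2, -, -⟩ := mom2 hG hv hu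
  obtain ⟨u2, -⟩ := mom1 hG hu
  obtain ⟨v2, -⟩ := mom1 hG hv
  obtain ⟨u1, ue⟩ := mean0 hG hu
  obtain ⟨v1, ve⟩ := mean0 hG hv
  have e : (fun ω => ((b + u ω) ^ 2 - (b ^ 2 + s)) * ((b + v ω) ^ 2 - (b ^ 2 + s))) =
     fun ω => (((((((u ω ^ 2 * v ω ^ 2 + (2 * b) * (u ω ^ 2 * v ω)) + (2 * b) * (v ω ^ 2 * u ω))
       + (4 * b ^ 2) * (u ω * v ω)) - s * u ω ^ 2) - s * v ω ^ 2) - (2 * b * s) * u ω)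
       - (2 * b * s) * v ω) + s ^ 2 := by
    funext ω; ring
  have I1 := i3.fun_add (i2.const_mul (2 * b))
  have I2 := I1.fun_add (j2.const_mul (2 * b))
  have I3 := I2.fun_add (i1.const_mul (4 * b ^ 2))
  have I4 := I3.fsub (u2.const_mul s)
  have I5 := I4.fsub (v2.const_mul s)
  have I6 := I5.fsub (u1.const_mul (2 * b * s))
  have I7 := I6.fsub (v1.const_mul (2 * b * s))
  have I8 := I7.fun_add (integrable_const (μ := μ) (s ^ 2))
  rw [e]
  refine ⟨I8, ?_⟩
  rw [integral_add I7 (integrable_const _), integral_sub I6 (v1.const_mul _),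
    integral_sub I5 (u1.const_mul _), integral_sub I4 (v2.const_mul _),
    integral_sub I3 (u2.const_mul _), integral_add I2 (i1.const_mul _),
    integral_add I1 (j2.const_mul _), integral_add i3 (i2.const_mul _)]
  simp only [integral_const_mul, e2, e3, f2, ue, ve, hus, hvs, integral_const, probReal_univ,
    smul_eq_mul]
  have hr : |∫ ω, u ω * v ω ∂μ| ≤ s := by
    calc |∫ ω, u ω * v ω ∂μ| ≤ ∫ ω, |u ω * v ω| ∂μ := abs_integral_le_integral_abs
      _ ≤ ∫ ω, (1/2) * (u ω ^ 2 + v ω ^ 2) ∂μ := by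
        refine integral_mono i1.abs ((u2.fun_add v2).const_mul _) fun ω => ?_
        simp only
        rw [abs_le]; constructor <;> nlinarith [sq_nonneg (u ω + v ω), sq_nonneg (u ω - v ω)]
      _ = s := by
        rw [integral_const_mul, integral_add u2 v2, hus, hvs]; ring
  set r := ∫ ω, u ω * v ω ∂μ
  have h0 := abs_nonneg r
  have h1 : r ^ 2 = |r| * |r| := by rw [← sq, sq_abs]
  have h2 := le_abs_self r
  nlinarith [mul_le_mul_of_nonneg_right hr h0, mul_le_mul_of_nonneg_left h2 (sq_nonneg b)]

lemma slln_sq {μ : Measure (ℕ → ℝ)} [IsProbabilityMeasure μ] (hG : GaussV μ)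
    (Z : ℕ → (ℕ → ℝ) → ℝ) (hZ : ∀ k, Z k ∈ linV) (b s C p : ℝ) (hC : 0 ≤ C) (hp : p < 2)
    (hs : ∀ k, ∫ ω, Z k ω ^ 2 ∂μ = s)
    (hsum : ∀ n : ℕ, 1 ≤ n → ∑ k ∈ range n, ∑ l ∈ range n, |∫ ω, Z k ω * Z l ω ∂μ|
      ≤ C * (n : ℝ) ^ p) :
    ∀ᵐ ω ∂μ, Tendsto (fun n : ℕ => (∑ k ∈ range n, (b + Z k ω) ^ 2) / n) atTop
      (nhds (b ^ 2 + s)) := by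
  have hs0 : 0 ≤ s := by rw [← hs 0]; exact integral_nonneg fun ω => sq_nonneg _
  have ex : ∀ (n : ℕ), (fun ω => (∑ k ∈ range n, (b + Z k ω) ^ 2 - n * (b ^ 2 + s)) ^ 2) =
      fun ω => ∑ k ∈ range n, ∑ l ∈ range n,
        ((b + Z k ω) ^ 2 - (b ^ 2 + s)) * ((b + Z l ω) ^ 2 - (b ^ 2 + s)) := by
    intro n; funext ω
    rw [← Finset.sum_mul_sum, ← sq, Finset.sum_sub_distrib]; simp [mul_add]
  have hii := fun k l => cov_sq hG (hZ k) (hZ l) b s (hs k) (hs l)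
  refine slln_aux μ (fun n ω => ∑ k ∈ range n, (b + Z k ω) ^ 2) (b ^ 2 + s)
    ((2 * s + 4 * b ^ 2) * C) p hp (by positivity) ?_ ?_ ?_ ?_
  · intro n
    exact Finset.measurable_fun_sum _ fun k _ => ((hG _ (hZ k)).1.const_add b).pow_const 2
  · intro ω
    refine monotone_nat_of_le_succ fun n => ?_
    rw [Finset.sum_range_succ]; nlinarith [sq_nonneg (b + Z n ω)]
  · intro n
    rw [ex]
    exact integrable_finsetSum _ fun k _ => integrable_finsetSum _ fun l _ => (hii k l).1
  · intro n hn
    rw [ex, integral_finsetSum _ fun k _ => integrable_finsetSum _ fun l _ => (hii k l).1]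
    calc ∑ k ∈ range n, ∫ ω, ∑ l ∈ range n,
        ((b + Z k ω) ^ 2 - (b ^ 2 + s)) * ((b + Z l ω) ^ 2 - (b ^ 2 + s)) ∂μ
        ≤ ∑ k ∈ range n, ∑ l ∈ range n, (2 * s + 4 * b ^ 2) * |∫ ω, Z k ω * Z l ω ∂μ| := by
          refine Finset.sum_le_sum fun k _ => ?_
          rw [integral_finsetSum _ fun l _ => (hii k l).1]
          exact Finset.sum_le_sum fun l _ => (hii k l).2
      _ = (2 * s + 4 * b ^ 2) * ∑ k ∈ range n, ∑ l ∈ range n, |∫ ω, Z k ω * Z l ω ∂μ| := by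
          simp_rw [← Finset.mul_sum]
      _ ≤ _ := by
          rw [mul_assoc]
          exact mul_le_mul_of_nonneg_left (hsum n hn) (by positivity)

lemma rhoH_neg (H : ℝ) (k : ℤ) : rhoH H (-k) = rhoH H k := by
  unfold rhoH
  have h1 : |((-k : ℤ) : ℝ) + 1| = |(k : ℝ) - 1| := by
    rw [← abs_neg]; congr 1; push_cast; ring
  have h2 : |((-k : ℤ) : ℝ) - 1| = |(k : ℝ) + 1| := by
    rw [← abs_neg]; congr 1; push_cast; ring
  have h3 : |((-k : ℤ) : ℝ)| = |(k : ℝ)| := by push_cast; rw [abs_neg]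
  rw [h1, h2, h3]; ring

lemma mixedCov_neg (σ γ h H : ℝ) (k : ℤ) : mixedCov σ γ h H (-k) = mixedCov σ γ h H k := by
  unfold mixedCov; rw [rhoH_neg]; simp

lemma mixedCov_sub_comm (σ γ h H : ℝ) (i j : ℤ) :
    mixedCov σ γ h H (i - j) = mixedCov σ γ h H (j - i) := by
  rw [← mixedCov_neg]; congr 1; ring

lemma rhoH_nonneg {H : ℝ} (hH : 1/2 < H) (k : ℤ) : 0 ≤ rhoH H k := by
  unfold rhoH
  have hp : 1 ≤ 2 * H := by linarith
  have h1 : |(k : ℝ)| ≤ (1/2) * |(k : ℝ) + 1| + (1/2) * |(k : ℝ) - 1| := by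
    have := abs_add_le ((k : ℝ) + 1) ((k : ℝ) - 1)
    have e : (k : ℝ) + 1 + (k - 1) = 2 * k := by ring
    rw [e, abs_mul] at this; norm_num at this; linarith
  have h2 := Real.rpow_le_rpow (abs_nonneg _) h1 (by linarith : 0 ≤ 2 * H)
  have h3 := (convexOn_rpow hp).2 (abs_nonneg ((k : ℝ) + 1)) (abs_nonneg ((k : ℝ) - 1))
    (by norm_num : (0 : ℝ) ≤ 1/2) (by norm_num : (0 : ℝ) ≤ 1/2) (by norm_num)
  simp only [smul_eq_mul] at h3
  linarith

lemma rhoH_zero {H : ℝ} (hH : 1/2 < H) : rhoH H 0 = 1 := by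
  unfold rhoH
  have : (2 * H) ≠ 0 := by linarith
  simp [Real.zero_rpow this]

lemma rhoH_sum1 {H : ℝ} (hH : 1/2 < H) (N : ℕ) :
    ∑ k ∈ range N, rhoH H ((k : ℤ) + 1) =
      (((N : ℝ) + 1) ^ (2 * H) - (N : ℝ) ^ (2 * H) - 1) / 2 := by
  have hne : (2 * H) ≠ 0 := by linarith
  induction N with
  | zero => simp [Real.zero_rpow hne]
  | succ n ih =>
    rw [Finset.sum_range_succ, ih]
    unfold rhoH
    push_cast
    rw [abs_of_nonneg (by positivity : (0 : ℝ) ≤ (n : ℝ) + 1 + 1),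
      abs_of_nonneg (by positivity : (0 : ℝ) ≤ (n : ℝ) + 1),
      abs_of_nonneg (by simp : (0 : ℝ) ≤ (n : ℝ) + 1 - 1)]
    rw [add_sub_cancel_right]; ring

lemma rhoH_sum2 {H : ℝ} (hH : 1/2 < H) (N : ℕ) :
    ∑ k ∈ range N, ∑ l ∈ range N, rhoH H ((k : ℤ) - (l : ℤ)) = (N : ℝ) ^ (2 * H) := by
  have hne : (2 * H) ≠ 0 := by linarith
  induction N with
  | zero => simp [Real.zero_rpow hne]
  | succ n ih =>
    have hr : ∑ k ∈ range n, rhoH H ((n : ℤ) - (k : ℤ)) =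
        (((n : ℝ) + 1) ^ (2 * H) - (n : ℝ) ^ (2 * H) - 1) / 2 := by
      rw [← rhoH_sum1 hH, ← Finset.sum_range_reflect]
      refine Finset.sum_congr rfl fun k hk => ?_
      rw [Finset.mem_range] at hk
      congr 1; omega
    have hr' : ∑ k ∈ range n, rhoH H ((k : ℤ) - (n : ℤ)) =
        (((n : ℝ) + 1) ^ (2 * H) - (n : ℝ) ^ (2 * H) - 1) / 2 := by
      rw [← hr]; refine Finset.sum_congr rfl fun k _ => ?_
      rw [← rhoH_neg]; congr 1; ring
    rw [Finset.sum_range_succ, Finset.sum_range_succ]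
    simp_rw [Finset.sum_range_succ (n := n)]
    rw [Finset.sum_add_distrib, ih, hr, hr', sub_self, rhoH_zero hH]
    push_cast; ring

lemma mixedCov_nonneg {σ γ h H : ℝ} (hh : 0 < h) (hH : 1/2 < H) (k : ℤ) :
    0 ≤ mixedCov σ γ h H k := by
  unfold mixedCov
  have := rhoH_nonneg hH k
  have : (0 : ℝ) ≤ if k = 0 then 1 else 0 := by split_ifs <;> norm_num
  positivity

lemma mixedCov_sum {σ γ h H : ℝ} (hH : 1/2 < H) (N : ℕ) :
    ∑ k ∈ range N, ∑ l ∈ range N, mixedCov σ γ h H ((k : ℤ) - (l : ℤ)) =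
      σ ^ 2 * h * N + γ ^ 2 * h ^ (2 * H) * (N : ℝ) ^ (2 * H) := by
  unfold mixedCov
  simp_rw [Finset.sum_add_distrib, ← Finset.mul_sum]
  rw [rhoH_sum2 hH]
  congr 2
  have : ∀ k ∈ range N, (∑ l ∈ range N, if (k : ℤ) - (l : ℤ) = 0 then (1 : ℝ) else 0) = 1 := by
    intro k hk
    simp only [sub_eq_zero, Nat.cast_inj]
    rw [Finset.sum_ite_eq, if_pos hk]
  rw [Finset.sum_congr rfl this]; simp

lemma gaussV_of {μ : Measure (ℕ → ℝ)} (c : ℤ → ℝ)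
    (hgauss : ∀ (n : ℕ) (a : Fin n → ℝ),
      Measure.map (fun ω : ℕ → ℝ => ∑ k : Fin n, a k * ω (k : ℕ)) μ =
        ProbabilityTheory.gaussianReal 0
          (Real.toNNReal (∑ i : Fin n, ∑ j : Fin n, a i * a j * c ((i : ℤ) - (j : ℤ))))) :
    GaussV μ := by
  intro u hu
  unfold linV at hu
  rw [Finsupp.mem_span_range_iff_exists_finsupp] at hu
  obtain ⟨f, hf⟩ := hu
  obtain ⟨n, hn⟩ := f.support.exists_nat_subset_range
  have e : u = fun ω : ℕ → ℝ => ∑ k : Fin n, f k * ω (k : ℕ) := by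
    funext ω
    rw [← hf, Finsupp.sum, Finset.sum_apply, Finset.sum_subset hn, Finset.sum_range]
    · rfl
    · intro x _ hx
      simp [Finsupp.notMem_support_iff.1 hx]
  have h1 := hgauss n fun k => f k
  rw [← e] at h1
  exact ⟨by rw [e]; fun_prop, _, h1⟩

lemma cov_coord {μ : Measure (ℕ → ℝ)} (c : ℤ → ℝ) (hc : ∀ k, 0 ≤ c k)
    (hsym : ∀ i j : ℤ, c (i - j) = c (j - i))
    (hgauss : ∀ (n : ℕ) (a : Fin n → ℝ),
      Measure.map (fun ω : ℕ → ℝ => ∑ k : Fin n, a k * ω (k : ℕ)) μ =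
        ProbabilityTheory.gaussianReal 0
          (Real.toNNReal (∑ i : Fin n, ∑ j : Fin n, a i * a j * c ((i : ℤ) - (j : ℤ)))))
    (i j : ℕ) : ∫ ω, ω i * ω j ∂μ = c ((i : ℤ) - (j : ℤ)) := by
  have hG := gaussV_of c hgauss
  have key : ∀ i j : ℕ, ∫ ω, (ω i + ω j) ^ 2 ∂μ = 2 * c 0 + 2 * c ((i : ℤ) - (j : ℤ)) := by
    intro i j
    set N := i + j + 1 with hN
    let a : ℕ → ℝ := fun k => (if i = k then 1 else 0) + (if j = k then 1 else 0)
    have hi : i ∈ range N := by rw [Finset.mem_range]; omega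
    have hj : j ∈ range N := by rw [Finset.mem_range]; omega
    have h1 := hgauss N fun k => a k
    have e1 : (fun ω : ℕ → ℝ => ∑ k : Fin N, a k * ω (k : ℕ)) = fun ω => ω i + ω j := by
      funext ω
      rw [← Finset.sum_range (fun k => a k * ω k)]
      simp only [a, add_mul, Finset.sum_add_distrib, ite_mul, one_mul, zero_mul,
        Finset.sum_ite_eq, hi, hj, if_true]
    have e2 : (∑ k : Fin N, ∑ l : Fin N, a k * a l * c ((k : ℤ) - (l : ℤ))) =
        2 * c 0 + 2 * c ((i : ℤ) - (j : ℤ)) := by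
      have : ∀ k : Fin N, (∑ l : Fin N, a k * a l * c ((k : ℤ) - (l : ℤ))) =
          ∑ l ∈ range N, a k * a l * c (((k : ℕ) : ℤ) - (l : ℤ)) := by
        intro k; rw [Finset.sum_range]
      simp_rw [this]
      rw [← Finset.sum_range (fun k => ∑ l ∈ range N, a k * a l * c ((k : ℤ) - (l : ℤ)))]
      simp only [mul_assoc, ← Finset.mul_sum]
      simp only [a, add_mul, Finset.sum_add_distrib, ite_mul, one_mul, zero_mul,
        Finset.sum_ite_eq, hi, hj, if_true, sub_self]
      rw [hsym j i]; ring
    rw [e1, e2] at h1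
    have hm : Measurable fun ω : ℕ → ℝ => ω i + ω j := by fun_prop
    have h2 := integral_map (μ := μ) hm.aemeasurable (f := fun x : ℝ => x ^ 2) (by fun_prop)
    rw [← h2, h1, (gauss_moments _).1, Real.coe_toNNReal]
    have := hc 0; have := hc ((i : ℤ) - (j : ℤ)); positivity
  have sq : ∀ i : ℕ, ∫ ω, (ω i) ^ 2 ∂μ = c 0 := by
    intro i
    have h := key i i
    have e : (fun ω : ℕ → ℝ => (ω i + ω i) ^ 2) = fun ω => 4 * (ω i) ^ 2 := by funext ω; ring
    rw [e, integral_const_mul, sub_self] at h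
    linarith
  have hk := key i j
  obtain ⟨i1, -⟩ := mom2 hG (coord_mem i) (coord_mem j)
  obtain ⟨u2, -⟩ := mom1 hG (coord_mem i)
  obtain ⟨v2, -⟩ := mom1 hG (coord_mem j)
  have s1 : ∫ ω, (ω i + ω j) ^ 2 ∂μ =
      ∫ ω, ω i ^ 2 ∂μ + ∫ ω, ω j ^ 2 ∂μ + 2 * ∫ ω, ω i * ω j ∂μ := by
    rw [← integral_const_mul, ← integral_add u2 v2, ← integral_add (u2.fun_add v2) (i1.const_mul 2)]
    congr 1; funext ω; ring
  rw [sq, sq] at s1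
  linarith

lemma shift_sum_le (g : ℕ → ℝ) (hg : ∀ k, 0 ≤ g k) (n i : ℕ) (hi : i < 4) :
    ∑ k ∈ range n, g (k + i) ≤ ∑ k ∈ range (n + 4), g k := by
  rw [Finset.range_eq_Ico, Finset.sum_Ico_add']
  refine Finset.sum_le_sum_of_subset_of_nonneg ?_ fun k _ _ => hg k
  intro k hk
  simp only [Finset.mem_Ico, Finset.mem_range] at *
  omega

lemma slln_lin {σ γ h H : ℝ} (hh : 0 < h) (hH : 1/2 < H) (hH1 : H < 1)
    {μ : Measure (ℕ → ℝ)} [IsProbabilityMeasure μ]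
    (hG : GaussV μ)
    (hcov : ∀ i j : ℕ, ∫ ω, ω i * ω j ∂μ = mixedCov σ γ h H ((i : ℤ) - (j : ℤ)))
    (a : Fin 4 → ℝ) (b : ℝ) :
    ∀ᵐ ω ∂μ, Tendsto (fun n : ℕ =>
        (∑ k ∈ range n, (b + ∑ i : Fin 4, a i * ω (k + i)) ^ 2) / n) atTop
      (nhds (b ^ 2 + ∑ i : Fin 4, ∑ j : Fin 4, a i * a j * mixedCov σ γ h H ((i : ℤ) - (j : ℤ)))) := by
  have hc0 := fun k => mixedCov_nonneg (σ := σ) (γ := γ) hh hH k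
  have hZ : ∀ k : ℕ, (fun ω : ℕ → ℝ => ∑ i : Fin 4, a i * ω (k + i)) ∈ linV := by
    intro k
    have : (fun ω : ℕ → ℝ => ∑ i : Fin 4, a i * ω (k + i)) =
        ∑ i : Fin 4, a i • (fun ω : ℕ → ℝ => ω (k + i)) := by
      funext ω; simp
    rw [this]
    exact linV.sum_mem fun i _ => linV.smul_mem _ (coord_mem _)
  have hr : ∀ k l : ℕ, ∫ ω : ℕ → ℝ, (∑ i : Fin 4, a i * ω (k + i)) * (∑ i : Fin 4, a i * ω (l + i)) ∂μ
      = ∑ i : Fin 4, ∑ j : Fin 4, a i * a j *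
        mixedCov σ γ h H (((k + i : ℕ) : ℤ) - ((l + j : ℕ) : ℤ)) := by
    intro k l
    have hint : ∀ i j : Fin 4, Integrable (fun ω : ℕ → ℝ => a i * a j * (ω (k + i) * ω (l + j))) μ :=
      fun i j => ((mom2 hG (coord_mem (k + i)) (coord_mem (l + j))).1).const_mul _
    have e : (fun ω : ℕ → ℝ => (∑ i : Fin 4, a i * ω (k + i)) * (∑ i : Fin 4, a i * ω (l + i))) =
        fun ω => ∑ i : Fin 4, ∑ j : Fin 4, a i * a j * (ω (k + i) * ω (l + j)) := by
      funext ω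
      rw [Finset.sum_mul_sum]
      refine Finset.sum_congr rfl fun i _ => Finset.sum_congr rfl fun j _ => ?_
      ring
    rw [e, integral_finsetSum _ fun i _ => integrable_finsetSum _ fun j _ => hint i j]
    refine Finset.sum_congr rfl fun i _ => ?_
    rw [integral_finsetSum _ fun j _ => hint i j]
    refine Finset.sum_congr rfl fun j _ => ?_
    rw [integral_const_mul, hcov]
  set A := ∑ i : Fin 4, ∑ j : Fin 4, |a i * a j| with hA
  have hA0 : 0 ≤ A := Finset.sum_nonneg fun i _ => Finset.sum_nonneg fun j _ => abs_nonneg _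
  set K := σ ^ 2 * h + γ ^ 2 * h ^ (2 * H) with hK
  have hK0 : 0 ≤ K := by positivity
  refine slln_sq hG (fun k ω => ∑ i : Fin 4, a i * ω (k + i)) hZ b _
    (A * (K * 5 ^ (2 * H))) (2 * H) (by positivity) (by linarith) ?_ ?_
  · intro k
    simp only [sq]
    rw [hr k k]
    refine Finset.sum_congr rfl fun i _ => Finset.sum_congr rfl fun j _ => ?_
    congr 2; push_cast; ring
  · intro n hn
    have hn1 : (1 : ℝ) ≤ n := by exact_mod_cast hn
    set B := ∑ k ∈ range (n + 4), ∑ l ∈ range (n + 4), mixedCov σ γ h H ((k : ℤ) - (l : ℤ)) with hB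
    have hsh : ∀ i j : Fin 4, ∑ k ∈ range n, ∑ l ∈ range n,
        mixedCov σ γ h H (((k + i : ℕ) : ℤ) - ((l + j : ℕ) : ℤ)) ≤ B := by
      intro i j
      calc _ ≤ ∑ k ∈ range n, ∑ l ∈ range (n + 4),
            mixedCov σ γ h H (((k + i : ℕ) : ℤ) - ((l : ℕ) : ℤ)) :=
            Finset.sum_le_sum fun k _ => shift_sum_le
              (fun l => mixedCov σ γ h H (((k + i : ℕ) : ℤ) - (l : ℤ))) (fun _ => hc0 _) n j j.2
        _ ≤ B := shift_sum_le (fun k => ∑ l ∈ range (n + 4),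
            mixedCov σ γ h H ((k : ℤ) - (l : ℤ)))
            (fun _ => Finset.sum_nonneg fun _ _ => hc0 _) n i i.2
    have hB1 : B ≤ K * 5 ^ (2 * H) * (n : ℝ) ^ (2 * H) := by
      rw [hB, mixedCov_sum hH]
      have h4 : (1 : ℝ) ≤ ((n + 4 : ℕ) : ℝ) := by push_cast; linarith
      have h5 : ((n + 4 : ℕ) : ℝ) ≤ ((n + 4 : ℕ) : ℝ) ^ (2 * H) :=
        Real.self_le_rpow_of_one_le h4 (by linarith)
      have h6 : ((n + 4 : ℕ) : ℝ) ^ (2 * H) ≤ (5 * (n : ℝ)) ^ (2 * H) :=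
        Real.rpow_le_rpow (by positivity) (by push_cast; linarith) (by linarith)
      rw [Real.mul_rpow (by norm_num) (by positivity)] at h6
      calc _ ≤ σ ^ 2 * h * ((n + 4 : ℕ) : ℝ) ^ (2 * H) +
            γ ^ 2 * h ^ (2 * H) * ((n + 4 : ℕ) : ℝ) ^ (2 * H) := by gcongr
        _ = K * ((n + 4 : ℕ) : ℝ) ^ (2 * H) := by rw [hK]; ring
        _ ≤ _ := by rw [mul_assoc]; gcongr
    calc _ ≤ ∑ k ∈ range n, ∑ l ∈ range n, ∑ i : Fin 4, ∑ j : Fin 4, |a i * a j| *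
          mixedCov σ γ h H (((k + i : ℕ) : ℤ) - ((l + j : ℕ) : ℤ)) := by
          refine Finset.sum_le_sum fun k _ => Finset.sum_le_sum fun l _ => ?_
          rw [hr]
          refine (Finset.abs_sum_le_sum_abs _ _).trans (Finset.sum_le_sum fun i _ => ?_)
          refine (Finset.abs_sum_le_sum_abs _ _).trans (Finset.sum_le_sum fun j _ => ?_)
          rw [abs_mul, abs_of_nonneg (hc0 _)]
      _ = ∑ i : Fin 4, ∑ j : Fin 4, |a i * a j| * ∑ k ∈ range n, ∑ l ∈ range n,
          mixedCov σ γ h H (((k + i : ℕ) : ℤ) - ((l + j : ℕ) : ℤ)) := by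
          simp_rw [Finset.mul_sum]
          rw [Finset.sum_congr rfl fun k _ => Finset.sum_comm]
          rw [Finset.sum_comm]
          refine Finset.sum_congr rfl fun i _ => ?_
          rw [Finset.sum_congr rfl fun k _ => Finset.sum_comm]
          rw [Finset.sum_comm]
      _ ≤ ∑ i : Fin 4, ∑ j : Fin 4, |a i * a j| * B := by
          refine Finset.sum_le_sum fun i _ => Finset.sum_le_sum fun j _ => ?_
          exact mul_le_mul_of_nonneg_left (hsh i j) (abs_nonneg _)
      _ = A * B := by simp_rw [hA, Finset.sum_mul]
      _ ≤ A * (K * 5 ^ (2 * H) * (n : ℝ) ^ (2 * H)) := mul_le_mul_of_nonneg_left hB1 hA0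
      _ = _ := by ring

lemma slln4 {σ γ h H : ℝ} (hh : 0 < h) (hH : 1/2 < H) (hH1 : H < 1)
    {μ : Measure (ℕ → ℝ)} [IsProbabilityMeasure μ]
    (hG : GaussV μ)
    (hcov : ∀ i j : ℕ, ∫ ω, ω i * ω j ∂μ = mixedCov σ γ h H ((i : ℤ) - (j : ℤ)))
    (a0 a1 a2 a3 : ℝ) (b : ℝ) :
    ∀ᵐ ω ∂μ, Tendsto (fun n : ℕ => (1 / (n : ℝ)) *
        ∑ k ∈ range n, (b + (a0 * ω k + a1 * ω (k + 1) + a2 * ω (k + 2) + a3 * ω (k + 3))) ^ 2) atTop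
      (nhds (b ^ 2 + ((a0 ^ 2 + a1 ^ 2 + a2 ^ 2 + a3 ^ 2) * mixedCov σ γ h H 0 +
        2 * (a0 * a1 + a1 * a2 + a2 * a3) * mixedCov σ γ h H 1 +
        2 * (a0 * a2 + a1 * a3) * mixedCov σ γ h H 2 + 2 * (a0 * a3) * mixedCov σ γ h H 3))) := by
  filter_upwards [slln_lin hh hH hH1 hG hcov ![a0, a1, a2, a3] b] with ω hω
  have n1 := mixedCov_neg σ γ h H 1
  have n2 := mixedCov_neg σ γ h H 2
  have n3 := mixedCov_neg σ γ h H 3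
  convert hω using 1
  · funext n
    rw [one_div, inv_mul_eq_div]
    congr 1
    refine Finset.sum_congr rfl fun k _ => ?_
    simp [Fin.sum_univ_four]
  · congr 2
    simp [Fin.sum_univ_four]
    norm_num [n1, n2, n3]
    ring

lemma cov_vals {σ γ h H : ℝ} (hH : 1/2 < H) :
    mixedCov σ γ h H 0 = σ ^ 2 * h + γ ^ 2 * h ^ (2 * H) ∧
    mixedCov σ γ h H 1 = γ ^ 2 * h ^ (2 * H) * ((2 : ℝ) ^ (2 * H - 1) - 1) ∧
    mixedCov σ γ h H 1 + 2 * mixedCov σ γ h H 2 + mixedCov σ γ h H 3 =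
      (2 : ℝ) ^ (2 * H) * mixedCov σ γ h H 1 := by
  have hne : (2 * H) ≠ 0 := by linarith
  have h4 : (4 : ℝ) ^ (2 * H) = (2 : ℝ) ^ (2 * H) * (2 : ℝ) ^ (2 * H) := by
    rw [← Real.mul_rpow (by norm_num) (by norm_num)]; norm_num
  have hh : (2 : ℝ) ^ (2 * H - 1) = (2 : ℝ) ^ (2 * H) / 2 := by
    rw [Real.rpow_sub_one (by norm_num)]
  have r1 : rhoH H 1 = (2 : ℝ) ^ (2 * H) / 2 - 1 := by
    unfold rhoH; norm_num [Real.zero_rpow hne]; ring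
  have r2 : rhoH H 2 = ((3 : ℝ) ^ (2 * H) + 1 - 2 * (2 : ℝ) ^ (2 * H)) / 2 := by
    unfold rhoH; norm_num
  have r3 : rhoH H 3 = ((4 : ℝ) ^ (2 * H) + (2 : ℝ) ^ (2 * H) - 2 * (3 : ℝ) ^ (2 * H)) / 2 := by
    unfold rhoH; norm_num
  refine ⟨?_, ?_, ?_⟩
  · unfold mixedCov; rw [rhoH_zero hH]; simp
  · unfold mixedCov; rw [r1, hh]; simp
  · unfold mixedCov; rw [r1, r2, r3, h4]; norm_num; ring

/-- Strong consistency of the generalized-method-of-moments estimators of the drift,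
Hurst index, fractional scaling parameter and Brownian volatility built from one
discretely observed trajectory of a mixed fractional Brownian motion with drift. -/
theorem gmm_estimators_strongly_consistent
    (σ γ h H θ : ℝ) (hσ : 0 < σ) (hγ : 0 < γ) (hh : 0 < h)
    (hH : H ∈ Set.Ioo (1/2 : ℝ) 1)
    (μ : Measure (ℕ → ℝ)) [IsProbabilityMeasure μ]
    (hinv : MeasurePreserving shift μ μ)
    (hgauss : ∀ (n : ℕ) (a : Fin n → ℝ),
      Measure.map (fun ω : ℕ → ℝ => ∑ k : Fin n, a k * ω (k : ℕ)) μ =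
        ProbabilityTheory.gaussianReal 0
          (Real.toNNReal (∑ i : Fin n, ∑ j : Fin n,
            a i * a j * mixedCov σ γ h H ((i : ℤ) - (j : ℤ))))) :
    ∀ᵐ ω ∂μ,
      Tendsto (fun n : ℕ => thetaHat θ h n ω) atTop (nhds θ) ∧
      Tendsto (fun n : ℕ => Hhat θ h n ω) atTop (nhds H) ∧
      Tendsto (fun n : ℕ => gammaSqHat θ h n ω) atTop (nhds (γ ^ 2)) ∧
      Tendsto (fun n : ℕ => sigmaSqHat θ h n ω) atTop (nhds (σ ^ 2)) := by
  obtain ⟨hH0, hH1⟩ := hH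
  have hG : GaussV μ := gaussV_of (mixedCov σ γ h H) hgauss
  have hcov : ∀ i j : ℕ, ∫ ω, ω i * ω j ∂μ = mixedCov σ γ h H ((i : ℤ) - (j : ℤ)) :=
    cov_coord (mixedCov σ γ h H) (fun k => mixedCov_nonneg hh hH0 k)
      (fun i j => mixedCov_sub_comm σ γ h H i j) hgauss
  obtain ⟨hv0, hv1, hv2⟩ := cov_vals (σ := σ) (γ := γ) (h := h) hH0
  have L := slln4 hh hH0 hH1 hG hcov
  filter_upwards [L 1 0 0 0 (θ * h), L 1 0 0 0 (θ * h + 1), L 0 1 0 0 (θ * h),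
    L 1 1 0 0 (2 * (θ * h)), L 0 0 1 1 (2 * (θ * h)), L 1 1 1 1 (4 * (θ * h))]
    with ω t1 t2 t3 t4 t5 t6
  set c0 := mixedCov σ γ h H 0
  set c1 := mixedCov σ γ h H 1
  set c2 := mixedCov σ γ h H 2
  set c3 := mixedCov σ γ h H 3
  set G := γ ^ 2 * h ^ (2 * H) with hGdef
  have hhp : 0 < h ^ (2 * H) := Real.rpow_pos_of_pos hh _
  have h21 : 0 < (2 : ℝ) ^ (2 * H - 1) - 1 := by
    have := Real.one_lt_rpow (by norm_num : (1 : ℝ) < 2) (by linarith : 0 < 2 * H - 1)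
    linarith
  have hc1 : 0 < c1 := by rw [hv1]; positivity
  have hxi : Tendsto (fun n : ℕ => xiStat θ h n ω) atTop (nhds ((θ * h) ^ 2 + c0)) := by
    convert t1 using 2
    · unfold xiStat Yinc; simp
    · ring
  have hth : Tendsto (fun n : ℕ => thetaHat θ h n ω) atTop (nhds θ) := by
    have h1 := ((((t2.sub t1).sub_const 1).div_const 2).div_const h)
    have h2 := h1.congr' (f₂ := fun n : ℕ => thetaHat θ h n ω) ?_
    · convert h2 using 2
      field_simp; ring
    · filter_upwards [eventually_ge_atTop 1] with n hn
      have hn0 : (n : ℝ) ≠ 0 := by positivity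
      unfold thetaHat Yinc
      have : ∑ k ∈ range n, (θ * h + 1 + (1 * ω k + 0 * ω (k + 1) + 0 * ω (k + 2) + 0 * ω (k + 3))) ^ 2
          = ∑ k ∈ range n, (θ * h + (1 * ω k + 0 * ω (k + 1) + 0 * ω (k + 2) + 0 * ω (k + 3))) ^ 2
            + 2 * ∑ k ∈ range n, (θ * h + ω k) + n := by
        have hn' : (n : ℝ) = ∑ k ∈ range n, (1 : ℝ) := by simp
        rw [hn', Finset.mul_sum, ← Finset.sum_add_distrib, ← Finset.sum_add_distrib]
        refine Finset.sum_congr rfl fun k _ => ?_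
        ring
      rw [this]
      field_simp; ring
  have heta : Tendsto (fun n : ℕ => etaStat θ h n ω) atTop (nhds ((θ * h) ^ 2 + c1)) := by
    have h1 := ((t4.sub t1).sub t3).div_const 2
    convert h1 using 2
    · rename_i n
      unfold etaStat Yinc
      rw [← mul_sub, ← mul_sub, mul_div_assoc, ← Finset.sum_sub_distrib, ← Finset.sum_sub_distrib,
        Finset.sum_div]
      congr 1
      refine Finset.sum_congr rfl fun k _ => ?_
      ring
    · ring
  have hzeta : Tendsto (fun n : ℕ => zetaStat θ h n ω) atTop
      (nhds (4 * (θ * h) ^ 2 + (2 : ℝ) ^ (2 * H) * c1)) := by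
    have h1 := ((t6.sub t4).sub t5).div_const 2
    rw [← hv2]
    convert h1 using 2
    · rename_i n
      unfold zetaStat Yinc
      rw [← mul_sub, ← mul_sub, mul_div_assoc, ← Finset.sum_sub_distrib, ← Finset.sum_sub_distrib,
        Finset.sum_div]
      congr 1
      refine Finset.sum_congr rfl fun k _ => ?_
      ring
    · ring
  have hnum : Tendsto (fun n : ℕ => zetaStat θ h n ω - 4 * h ^ 2 * (thetaHat θ h n ω) ^ 2) atTop
      (nhds ((2 : ℝ) ^ (2 * H) * c1)) := by
    have := hzeta.sub ((hth.pow 2).const_mul (4 * h ^ 2))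
    convert this using 2; ring
  have hden : Tendsto (fun n : ℕ => etaStat θ h n ω - h ^ 2 * (thetaHat θ h n ω) ^ 2) atTop
      (nhds c1) := by
    have := heta.sub ((hth.pow 2).const_mul (h ^ 2))
    convert this using 2; ring
  have hratio := hnum.div hden hc1.ne'
  rw [mul_div_cancel_right₀ _ hc1.ne'] at hratio
  have h2p : (0 : ℝ) < 2 ^ (2 * H) := by positivity
  have hHhat : Tendsto (fun n : ℕ => Hhat θ h n ω) atTop (nhds H) := by
    have h1 := ((hratio.log h2p.ne').div_const (Real.log 2)).const_mul (1/2)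
    have e : 1 / 2 * (Real.log (2 ^ (2 * H)) / Real.log 2) = H := by
      have := Real.log_pos (by norm_num : (1 : ℝ) < 2)
      rw [Real.log_rpow (by norm_num)]; field_simp
    rw [e] at h1
    refine h1.congr' ?_
    filter_upwards [hratio.eventually (lt_mem_nhds h2p)] with n hn
    simp only [Pi.div_apply] at hn
    unfold Hhat log2plus
    rw [if_pos hn]
    rfl
  have hhH : Tendsto (fun n : ℕ => h ^ (2 * Hhat θ h n ω)) atTop (nhds (h ^ (2 * H))) :=
    tendsto_const_nhds.rpow (hHhat.const_mul 2) (Or.inl hh.ne')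
  have h2H : Tendsto (fun n : ℕ => (2 : ℝ) ^ (2 * Hhat θ h n ω - 1)) atTop
      (nhds ((2 : ℝ) ^ (2 * H - 1))) :=
    tendsto_const_nhds.rpow ((hHhat.const_mul 2).sub_const 1) (Or.inl (by norm_num))
  have hgam : Tendsto (fun n : ℕ => gammaSqHat θ h n ω) atTop (nhds (γ ^ 2)) := by
    have h1 := hden.div (hhH.mul (h2H.sub_const 1)) (by positivity)
    convert h1 using 2
    · rfl
    rw [hv1, hGdef]; field_simp
  refine ⟨hth, hHhat, hgam, ?_⟩
  have h1 := ((hxi.sub ((hth.pow 2).const_mul (h ^ 2))).sub (hgam.mul hhH)).div_const h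
  convert h1 using 2
  · rfl
  rw [hv0, hGdef]; field_simp; ring
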